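/- Let k ≥ 2 and let λ be an infinite cardinal. Suppose there is a family of cardinality λ of k-branching trees such that every function g : ℕ → {0,…,k} is a branch of some tree in the family. Then for every (k+1)-branching tree T (a subtree of the set of finite sequences of natural numbers), there exists a family of cardinality at most λ of k-trees such that every branch of T is a branch of some tree in that family. -/

import Mathlib

/-- A tree: a set of finite sequences of naturals closed under initial segments. -/
def IsTree (T : Set (List ℕ)) : Prop :=
  ∀ σ ∈ T, ∀ n : ℕ, σ.take n ∈ T

/-- The immediate successors of a node `σ` within `T`. -/
def succs (T : Set (List ℕ)) (σ : List ℕ) : Set ℕ :=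
  {m : ℕ | σ ++ [m] ∈ T}

/-- A `k`-tree: a tree in which every node has at least `1` and at most `k`
immediate successors. -/
def IsKTree (k : ℕ) (T : Set (List ℕ)) : Prop :=
  IsTree T ∧ ∀ σ ∈ T, 1 ≤ (succs T σ).encard ∧ (succs T σ).encard ≤ k

/-- The initial segment `f↾n = ⟨f 0, …, f (n-1)⟩`. -/
def seg (f : ℕ → ℕ) (n : ℕ) : List ℕ :=
  List.ofFn fun i : Fin n => f i

/-- `f` is a branch of `T` if all its finite initial segments belong to `T`. -/
def IsBranch (T : Set (List ℕ)) (f : ℕ → ℕ) : Prop :=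
  ∀ n : ℕ, seg f n ∈ T

/-- A `k`-branching tree: a tree in which every node has either exactly `1` or
exactly `k` immediate successors. -/
def IsKBranching (k : ℕ) (T : Set (List ℕ)) : Prop :=
  IsTree T ∧ ∀ σ ∈ T, (succs T σ).encard = 1 ∨ (succs T σ).encard = k

theorem length_seg (f : ℕ → ℕ) (n : ℕ) : (seg f n).length = n := by
  simp [seg]

theorem seg_succ (f : ℕ → ℕ) (n : ℕ) : seg f (n + 1) = seg f n ++ [f n] := by
  simp only [seg, List.ofFn_succ_last, Fin.val_castSucc, Fin.val_last]

theorem take_seg (f : ℕ → ℕ) {m n : ℕ} (h : m ≤ n) : (seg f n).take m = seg f m := by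
  apply List.ext_getElem
  · simp [seg, h]
  · simp [seg]

theorem seg_congr {f g : ℕ → ℕ} {n : ℕ} (h : ∀ i < n, f i = g i) : seg f n = seg g n := by
  simp only [seg]
  congr 1
  funext i
  exact h i i.2

theorem succs_eq_empty {T : Set (List ℕ)} (hT : IsTree T) {σ : List ℕ} (hσ : σ ∉ T) :
    succs T σ = ∅ := by
  refine Set.eq_empty_of_forall_notMem fun m hm => hσ ?_
  simpa using hT _ hm σ.length

theorem IsKBranching.encard_succs_le {k : ℕ} (hk : 1 ≤ k) {U : Set (List ℕ)}
    (hU : IsKBranching k U) (σ : List ℕ) : (succs U σ).encard ≤ k := by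
  by_cases hσ : σ ∈ U
  · rcases hU.2 σ hσ with h | h
    · rw [h]
      exact_mod_cast hk
    · exact h.le
  · simp [succs_eq_empty hU.1 hσ]

/-- The nodes of `T` that are reached from the root by edges satisfying `P`. -/
def prune (T : Set (List ℕ)) (P : List ℕ → ℕ → Prop) : Set (List ℕ) :=
  {σ | σ ∈ T ∧ ∀ τ m, τ ++ [m] <+: σ → P τ m}

theorem IsTree.prune {T : Set (List ℕ)} (hT : IsTree T) (P : List ℕ → ℕ → Prop) :
    IsTree (prune T P) :=
  fun σ hσ n => ⟨hT σ hσ.1 n, fun τ m h => hσ.2 τ m (h.trans (List.take_prefix n σ))⟩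

theorem succs_prune {T : Set (List ℕ)} {P : List ℕ → ℕ → Prop} {σ : List ℕ}
    (hσ : σ ∈ prune T P) : succs (prune T P) σ = {m ∈ succs T σ | P σ m} := by
  ext m
  constructor
  · exact fun h => ⟨h.1, h.2 σ m List.prefix_rfl⟩
  · refine fun h => ⟨h.1, fun τ m' hτ => ?_⟩
    rcases List.prefix_concat_iff.1 hτ with heq | hpre
    · obtain ⟨rfl, hm⟩ := List.append_inj' heq rfl
      obtain rfl : m' = m := by simpa using hm
      exact h.2
    · exact hσ.2 τ m' hpre

theorem IsBranch.prune {T : Set (List ℕ)} {P : List ℕ → ℕ → Prop} {f : ℕ → ℕ}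
    (hf : IsBranch T f) (hP : ∀ n, P (seg f n) (f n)) : IsBranch (prune T P) f := by
  refine fun n => ⟨hf n, fun τ m h => ?_⟩
  have hlen : τ.length + 1 ≤ n := by simpa [length_seg] using h.length_le
  have heq : τ ++ [m] = seg f τ.length ++ [f τ.length] := by
    rw [← seg_succ, ← take_seg f hlen]
    simpa using List.prefix_iff_eq_take.1 h
  obtain ⟨hτ, hm⟩ := List.append_inj' heq rfl
  obtain rfl : m = f τ.length := by simpa using hm
  rw [hτ, length_seg]
  exact hP _

/-- The sequence of labels of the edges on the path from the root to `σ`, where the edge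
from `τ` to `τ ++ [m]` is labelled `e τ m`. -/
def labels (e : List ℕ → ℕ → ℕ) (σ : List ℕ) : List ℕ :=
  seg (fun i => e (σ.take i) (σ.getD i 0)) σ.length

theorem labels_seg (e : List ℕ → ℕ → ℕ) (f : ℕ → ℕ) (n : ℕ) :
    labels e (seg f n) = seg (fun i => e (seg f i) (f i)) n := by
  rw [labels, length_seg]
  refine seg_congr fun i hi => ?_
  rw [take_seg f hi.le]
  simp [seg, hi]

open Classical in
/-- The successors of `σ` in `U` that are at most `k`, or `{0}` if there are none. -/
noncomputable def boundedSuccs (k : ℕ) (U : Set (List ℕ)) (σ : List ℕ) : Set ℕ :=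
  if (succs U σ ∩ Set.Iic k).Nonempty then succs U σ ∩ Set.Iic k else {0}

theorem boundedSuccs_nonempty (k : ℕ) (U : Set (List ℕ)) (σ : List ℕ) :
    (boundedSuccs k U σ).Nonempty := by
  unfold boundedSuccs
  split_ifs with h
  · exact h
  · exact Set.singleton_nonempty 0

theorem boundedSuccs_subset (k : ℕ) (U : Set (List ℕ)) (σ : List ℕ) :
    boundedSuccs k U σ ⊆ Set.Iic k := by
  unfold boundedSuccs
  split_ifs
  · exact Set.inter_subset_right
  · simp

theorem encard_boundedSuccs_le {k : ℕ} (hk : 1 ≤ k) {U : Set (List ℕ)} {σ : List ℕ}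
    (h : (succs U σ).encard ≤ k) : (boundedSuccs k U σ).encard ≤ k := by
  unfold boundedSuccs
  split_ifs
  · exact (Set.encard_le_encard Set.inter_subset_left).trans h
  · rw [Set.encard_singleton]
    exact_mod_cast hk

theorem mem_boundedSuccs {k : ℕ} {U : Set (List ℕ)} {σ : List ℕ} {m : ℕ}
    (hm : m ∈ succs U σ) (hmk : m ≤ k) : m ∈ boundedSuccs k U σ := by
  have hmem : m ∈ succs U σ ∩ Set.Iic k := ⟨hm, hmk⟩
  rw [boundedSuccs, if_pos ⟨m, hmem⟩]
  exact hmem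

theorem exists_bijOn_Iic {k : ℕ} {s : Set ℕ} (hs : s.encard = (k + 1 : ℕ)) :
    ∃ e : ℕ → ℕ, Set.BijOn e s (Set.Iic k) := by
  have hfin : s.Finite := Set.finite_of_encard_eq_coe hs
  refine hfin.exists_bijOn_of_encard_eq ?_
  rw [hs, ← Finset.coe_Iic, Set.encard_coe_eq_coe_finsetCard, Nat.card_Iic]

theorem exists_labelling (k : ℕ) (s : Set ℕ) :
    ∃ e : ℕ → ℕ, Set.MapsTo e s (Set.Iic k) ∧
      (s.encard = (k + 1 : ℕ) → Set.BijOn e s (Set.Iic k)) := by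
  by_cases hs : s.encard = (k + 1 : ℕ)
  · obtain ⟨e, he⟩ := exists_bijOn_Iic hs
    exact ⟨e, he.mapsTo, fun _ => he⟩
  · exact ⟨fun _ => 0, fun _ _ => Nat.zero_le k, fun h => absurd h hs⟩

/-- The subtree of `T` in which, at the nodes with `k + 1` successors, only the edges whose
label is allowed by `U` are kept. -/
def pullback (k : ℕ) (T : Set (List ℕ)) (e : List ℕ → ℕ → ℕ) (U : Set (List ℕ)) :
    Set (List ℕ) :=
  prune T fun σ m =>
    (succs T σ).encard = (k + 1 : ℕ) → e σ m ∈ boundedSuccs k U (labels e σ)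

theorem isKTree_pullback {k : ℕ} (hk : 1 ≤ k) {T U : Set (List ℕ)}
    (hT : IsKBranching (k + 1) T) (hU : IsKBranching k U) {e : List ℕ → ℕ → ℕ}
    (he : ∀ σ, (succs T σ).encard = (k + 1 : ℕ) → Set.BijOn (e σ) (succs T σ) (Set.Iic k)) :
    IsKTree k (pullback k T e U) := by
  refine ⟨hT.1.prune _, fun σ hσ => ?_⟩
  rw [pullback, succs_prune hσ]
  by_cases hs : (succs T σ).encard = (k + 1 : ℕ)
  · simp only [hs, true_imp_iff]
    constructor
    · rw [Set.one_le_encard_iff_nonempty]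
      obtain ⟨i, hi⟩ := boundedSuccs_nonempty k U (labels e σ)
      obtain ⟨m, hm, rfl⟩ := (he σ hs).surjOn (boundedSuccs_subset _ _ _ hi)
      exact ⟨m, hm, hi⟩
    · exact (Set.encard_le_encard_of_injOn (fun m hm => hm.2)
        ((he σ hs).injOn.mono fun m hm => hm.1)).trans
        (encard_boundedSuccs_le hk (hU.encard_succs_le hk _))
  · have h1 : (succs T σ).encard = 1 := (hT.2 σ hσ.1).resolve_right hs
    have hall : {m ∈ succs T σ | (succs T σ).encard = (k + 1 : ℕ) →
        e σ m ∈ boundedSuccs k U (labels e σ)} = succs T σ :=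
      Set.ext fun m => ⟨And.left, fun hm => ⟨hm, fun h => absurd h hs⟩⟩
    rw [hall, h1]
    exact ⟨le_rfl, by exact_mod_cast hk⟩

theorem IsBranch.pullback {k : ℕ} {T U : Set (List ℕ)} {e : List ℕ → ℕ → ℕ} {f : ℕ → ℕ}
    (hf : IsBranch T f) (hle : ∀ n, e (seg f n) (f n) ≤ k)
    (hU : IsBranch U fun n => e (seg f n) (f n)) : IsBranch (pullback k T e U) f := by
  refine hf.prune fun n _ => mem_boundedSuccs ?_ (hle n)
  have h := hU (n + 1)
  rw [seg_succ, ← labels_seg] at h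
  exact h

theorem stmt16 (k : ℕ) (hk : 2 ≤ k) (lam : Cardinal) (hlam : Cardinal.aleph0 ≤ lam)
    (hcov : ∃ 𝒦 : Set (Set (List ℕ)), Cardinal.mk 𝒦 = lam ∧
      (∀ U ∈ 𝒦, IsKBranching k U) ∧
      ∀ g : ℕ → ℕ, (∀ n, g n ≤ k) → ∃ U ∈ 𝒦, IsBranch U g)
    (T : Set (List ℕ)) (hT : IsKBranching (k + 1) T) :
    ∃ 𝒯 : Set (Set (List ℕ)), Cardinal.mk 𝒯 ≤ lam ∧
      (∀ U ∈ 𝒯, IsKTree k U) ∧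
      ∀ f : ℕ → ℕ, IsBranch T f → ∃ U ∈ 𝒯, IsBranch U f := by
  obtain ⟨𝒦, hcard, h𝒦, hcover⟩ := hcov
  have hk1 : 1 ≤ k := one_le_two.trans hk
  choose e hmaps hbij using fun σ => exists_labelling k (succs T σ)
  refine ⟨pullback k T e '' 𝒦, Cardinal.mk_image_le.trans hcard.le, ?_, fun f hf => ?_⟩
  · rintro _ ⟨U, hU, rfl⟩
    exact isKTree_pullback hk1 hT (h𝒦 U hU) hbij
  · have hle : ∀ n, e (seg f n) (f n) ≤ k := fun n => hmaps _ <| by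
      have h := hf (n + 1)
      rwa [seg_succ] at h
    obtain ⟨U, hU, hUf⟩ := hcover _ hle
    exact ⟨_, Set.mem_image_of_mem _ hU, hf.pullback hle hUf⟩
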